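/- arXiv:1607.02575 — 2 statements merged into one kernel-verified Lean document; each statement's English description precedes it below -/
import Mathlib

section
/- Let G be a countable group acting on a compact metrizable space X by homeomorphisms with a point x₀ having dense orbit, let A ⊂ X be an open set, and let (Y, ν) be a probability measure-preserving Borel G-space. Then for every Borel set C ⊂ Y and every x ∈ X, one has ν(A_{x₀}⁻¹ C) ≥ ν(A_x⁻¹ C), where A_z = {g ∈ G : g·z ∈ A} and for S ⊂ G, S⁻¹C = ∪_{s∈S} s⁻¹C. -/
open MeasureTheory
open scoped Pointwise

/-- Let `(X, x₀)` be a compact pointed `G`-space (G countable, acting by homeomorphisms,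
with `G·x₀` dense), `A ⊆ X` open, and `(Y, ν)` a probability measure-preserving Borel
`G`-space. Then for every Borel `C ⊆ Y` and every `x ∈ X`,
`ν(A_{x₀}⁻¹C) ≥ ν(A_x⁻¹C)`, where `A_z = {g : g•z ∈ A}` and `S⁻¹C = ⋃_{s ∈ S} s⁻¹•C`. -/
theorem nu_actionSet_basepoint_ge {G X Y : Type*} [Group G] [Countable G]
    [TopologicalSpace X] [CompactSpace X] [TopologicalSpace.MetrizableSpace X]
    [MulAction G X] (hcont : ∀ g : G, Continuous fun x : X => g • x)
    (x₀ : X) (hx₀ : Dense (Set.range fun g : G => g • x₀))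
    [MeasurableSpace Y] [MulAction G Y]
    (hmeasY : ∀ g : G, Measurable fun y : Y => g • y)
    (ν : Measure Y) [IsProbabilityMeasure ν]
    (hν : ∀ g : G, Measure.map (fun y : Y => g • y) ν = ν)
    (A : Set X) (hA : IsOpen A) (C : Set Y) (hC : MeasurableSet C) (x : X) :
    ν (⋃ g ∈ {g : G | g • x ∈ A}, g⁻¹ • C) ≤
      ν (⋃ g ∈ {g : G | g • x₀ ∈ A}, g⁻¹ • C) := by
  have hmeas (g : G) : MeasurableSet (g⁻¹ • C) := by
    rw [← Set.preimage_smul]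
    exact hmeasY g hC
  rw [Set.biUnion_eq_iUnion, Set.iUnion_eq_iUnion_finset, Directed.measure_iUnion]
  · refine iSup_le fun F => ?_
    -- By density, some translate `h • x₀` is close enough to `x` that `F * h ⊆ A_{x₀}`.
    obtain ⟨_, hz, h, rfl⟩ := hx₀.inter_open_nonempty
      (⋂ g ∈ F, (fun z : X => (g : G) • z) ⁻¹' A)
      (isOpen_biInter_finset fun g _ => hA.preimage (hcont g))
      ⟨x, Set.mem_iInter₂.2 fun g _ => g.2⟩
    rw [← hν h, Measure.map_apply (hmeasY h)
      (F.measurableSet_biUnion fun g _ => hmeas g), hν h]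
    refine measure_mono fun y hy => ?_
    obtain ⟨g, hgF, hgy⟩ := Set.mem_iUnion₂.1 hy
    refine Set.mem_iUnion₂.2 ⟨g * h, ?_, ?_⟩
    · simpa only [Set.mem_ofPred_eq, Set.mem_preimage, mul_smul] using Set.mem_iInter₂.1 hz g hgF
    · rw [Set.mem_inv_smul_set_iff] at hgy ⊢
      rwa [mul_smul]
  · exact Monotone.directed_le fun F F' hF => Set.biUnion_subset_biUnion_left hF
end

section
/- Let G be a countable amenable group which is the semidirect product of an abelian normal subgroup N and an abelian subgroup L. If C ⊂ G is left N-invariant (NC = C) and D ⊂ G is left L-invariant (LD = D), then λ(C ∩ D) = λ(C)·λ(D) for every extreme left-invariant mean λ on G. -/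
open scoped Classical BoundedContinuousFunction

/-- Left translation `t ↦ g⁻¹ * t` as a continuous map (G discrete). -/
def lTransMap (G : Type*) [Group G] [TopologicalSpace G] [DiscreteTopology G] (g : G) :
    C(G, G) := ⟨fun t => g⁻¹ * t, continuous_of_discreteTopology⟩

/-- The left translation action on ℓ∞(G): `(g · φ)(t) = φ(g⁻¹ t)`. -/
noncomputable def lTrans (G : Type*) [Group G] [TopologicalSpace G] [DiscreteTopology G]
    (g : G) (f : G →ᵇ ℝ) : G →ᵇ ℝ := f.compContinuous (lTransMap G g)

/-- A mean on G: a positive unital linear functional on ℓ∞(G). -/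
def IsMean (G : Type*) [Group G] [TopologicalSpace G] [DiscreteTopology G]
    (m : (G →ᵇ ℝ) →ₗ[ℝ] ℝ) : Prop :=
  m 1 = 1 ∧ ∀ f : G →ᵇ ℝ, 0 ≤ f → 0 ≤ m f

/-- A left-invariant mean on G. -/
def IsLeftInvariantMean (G : Type*) [Group G] [TopologicalSpace G] [DiscreteTopology G]
    (m : (G →ᵇ ℝ) →ₗ[ℝ] ℝ) : Prop :=
  IsMean G m ∧ ∀ (g : G) (f : G →ᵇ ℝ), m (lTrans G g f) = m f

/-- The indicator function of a set, as an element of ℓ∞(G). -/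
noncomputable def indBCF (G : Type*) [Group G] [TopologicalSpace G] [DiscreteTopology G]
    (A : Set G) : G →ᵇ ℝ :=
  BoundedContinuousFunction.ofNormedAddCommGroup (Set.indicator A 1)
    continuous_of_discreteTopology 1 (by
      intro x
      by_cases h : x ∈ A <;> simp [Set.indicator_apply, h])

open scoped Pointwise

section Means

variable {G : Type*} [Group G] [TopologicalSpace G] [DiscreteTopology G]

lemma lTrans_apply (g : G) (f : G →ᵇ ℝ) (t : G) : lTrans G g f t = f (g⁻¹ * t) := rfl

lemma indBCF_apply (A : Set G) (t : G) : indBCF G A t = if t ∈ A then 1 else 0 := by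
  simp [indBCF, Set.indicator_apply]

lemma indBCF_nonneg (A : Set G) : 0 ≤ indBCF G A := fun t => by
  change 0 ≤ indBCF G A t
  rw [indBCF_apply]
  split_ifs <;> simp

lemma indBCF_le_one (A : Set G) : indBCF G A ≤ 1 := fun t => by
  change indBCF G A t ≤ 1
  rw [indBCF_apply]
  split_ifs <;> simp

lemma lTrans_mul (h g : G) (f : G →ᵇ ℝ) : lTrans G (h * g) f = lTrans G h (lTrans G g f) := by
  ext t
  simp [lTrans_apply, mul_assoc]

lemma lTrans_mul_mul (h : G) (f f' : G →ᵇ ℝ) :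
    lTrans G h (f * f') = lTrans G h f * lTrans G h f' := rfl

lemma lTrans_mul_left (h g : G) (f f' : G →ᵇ ℝ) :
    lTrans G g f * lTrans G h f' = lTrans G h (lTrans G (h⁻¹ * g) f * f') := by
  rw [lTrans_mul_mul, ← lTrans_mul, mul_inv_cancel_left]

lemma IsMean.mono {m : (G →ᵇ ℝ) →ₗ[ℝ] ℝ} (hm : IsMean G m) {f f' : G →ᵇ ℝ} (h : f ≤ f') :
    m f ≤ m f' := by
  have := hm.2 (f' - f) (sub_nonneg.2 h)
  rw [map_sub] at this
  linarith

lemma IsMean.map_const {m : (G →ᵇ ℝ) →ₗ[ℝ] ℝ} (hm : IsMean G m) (c : ℝ) :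
    m (BoundedContinuousFunction.const G c) = c := by
  have : BoundedContinuousFunction.const G c = c • (1 : G →ᵇ ℝ) := by
    ext t
    simp
  rw [this, map_smul, hm.1, smul_eq_mul, mul_one]

lemma IsMean.abs_le_norm {m : (G →ᵇ ℝ) →ₗ[ℝ] ℝ} (hm : IsMean G m) (f : G →ᵇ ℝ) :
    |m f| ≤ ‖f‖ := by
  rw [abs_le]
  constructor
  · rw [← hm.map_const (-‖f‖)]
    exact hm.mono fun t => (abs_le.1 (f.norm_coe_le_norm t)).1
  · rw [← hm.map_const ‖f‖]
    exact hm.mono fun t => (abs_le.1 (f.norm_coe_le_norm t)).2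

/-- An invariant positive functional dominated by an extreme left-invariant mean is a multiple
of that mean. -/
lemma eq_mul_of_le_extreme {lam m : (G →ᵇ ℝ) →ₗ[ℝ] ℝ}
    (hlam : lam ∈ Set.extremePoints ℝ {m : (G →ᵇ ℝ) →ₗ[ℝ] ℝ | IsLeftInvariantMean G m})
    (hpos : ∀ f : G →ᵇ ℝ, 0 ≤ f → 0 ≤ m f) (hle : ∀ f : G →ᵇ ℝ, 0 ≤ f → m f ≤ lam f)
    (hinv : ∀ (g : G) (f : G →ᵇ ℝ), m (lTrans G g f) = m f) (f : G →ᵇ ℝ) :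
    m f = m 1 * lam f := by
  obtain ⟨⟨⟨hone, hlpos⟩, hlinv⟩, hext⟩ := hlam
  have h0 : 0 ≤ m 1 := hpos 1 fun _ => zero_le_one
  have h1 : m 1 ≤ 1 := hone ▸ hle 1 fun _ => zero_le_one
  have hplus : IsLeftInvariantMean G (lam + (m - m 1 • lam)) := by
    refine ⟨⟨by simp [hone], fun f hf => ?_⟩, fun g f => by simp [hlinv, hinv]⟩
    have := mul_nonneg (sub_nonneg.2 h1) (hlpos f hf)
    have := hpos f hf
    simp only [LinearMap.add_apply, LinearMap.sub_apply, LinearMap.smul_apply, smul_eq_mul]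
    linarith
  have hminus : IsLeftInvariantMean G (lam - (m - m 1 • lam)) := by
    refine ⟨⟨by simp [hone], fun f hf => ?_⟩, fun g f => by simp [hlinv, hinv]⟩
    have := mul_nonneg h0 (hlpos f hf)
    have := hle f hf
    simp only [LinearMap.sub_apply, LinearMap.smul_apply, smul_eq_mul]
    linarith
  have hseg : lam ∈ openSegment ℝ (lam + (m - m 1 • lam)) (lam - (m - m 1 • lam)) :=
    ⟨1 / 2, 1 / 2, by norm_num, by norm_num, by norm_num, by module⟩
  have := LinearMap.congr_fun (hext hplus hminus hseg) f
  simp only [LinearMap.add_apply, LinearMap.sub_apply, LinearMap.smul_apply, smul_eq_mul] at this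
  linarith

/-- The bounded function `g ↦ m ((g · φ) ψ)`, linearly in `ψ`. -/
noncomputable def correlation (m : (G →ᵇ ℝ) →ₗ[ℝ] ℝ) (hm : IsMean G m) (φ : G →ᵇ ℝ) :
    (G →ᵇ ℝ) →ₗ[ℝ] (G →ᵇ ℝ) where
  toFun ψ := BoundedContinuousFunction.ofNormedAddCommGroup (fun g => m (lTrans G g φ * ψ))
    continuous_of_discreteTopology (‖φ‖ * ‖ψ‖) fun g =>
      (hm.abs_le_norm _).trans <| (norm_mul_le _ _).trans <|
        mul_le_mul_of_nonneg_right (φ.norm_compContinuous_le _) (norm_nonneg ψ)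
  map_add' ψ ψ' := by
    ext g
    simp [mul_add]
  map_smul' c ψ := by
    ext g
    have : lTrans G g φ * c • ψ = c • (lTrans G g φ * ψ) := by
      ext t
      simp [mul_left_comm]
    simp [this]

lemma correlation_apply (m : (G →ᵇ ℝ) →ₗ[ℝ] ℝ) (hm : IsMean G m) (φ ψ : G →ᵇ ℝ) (g : G) :
    correlation m hm φ ψ g = m (lTrans G g φ * ψ) := rfl

/-- The weak ergodic theorem: the `η`-average of `g ↦ λ ((g · φ) ψ)` is `λ φ * λ ψ` for an extreme
left-invariant mean `λ` and a left-invariant mean `η`. -/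
lemma weak_ergodic {lam η : (G →ᵇ ℝ) →ₗ[ℝ] ℝ}
    (hlam : lam ∈ Set.extremePoints ℝ {m : (G →ᵇ ℝ) →ₗ[ℝ] ℝ | IsLeftInvariantMean G m})
    (hη : IsLeftInvariantMean G η) {φ : G →ᵇ ℝ} (hφ0 : 0 ≤ φ) (hφ1 : φ ≤ 1) (ψ : G →ᵇ ℝ) :
    η (correlation lam hlam.1.1 φ ψ) = lam φ * lam ψ := by
  have hm := hlam.1.1
  have hone : η (correlation lam hm φ 1) = lam φ := by
    rw [← hη.1.map_const (lam φ)]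
    congr 1
    ext g
    simp [correlation_apply, hlam.1.2]
  rw [← hone]
  refine eq_mul_of_le_extreme (m := η ∘ₗ correlation lam hm φ) hlam (fun f hf => ?_)
    (fun f hf => ?_) (fun h f => ?_) ψ
  · exact hη.1.2 _ fun g => hm.2 _ fun t => mul_nonneg (hφ0 (g⁻¹ * t)) (hf t)
  · rw [← hη.1.map_const (lam f)]
    exact hη.1.mono fun g => hm.mono fun t => mul_le_of_le_one_left (hf t) (hφ1 (g⁻¹ * t))
  · rw [LinearMap.comp_apply, LinearMap.comp_apply, ← hη.2 h (correlation lam hm φ f)]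
    congr 1
    ext g
    rw [lTrans_apply, correlation_apply, correlation_apply, lTrans_mul_left, hlam.1.2]

lemma lTrans_indBCF_of_mem {H : Subgroup G} {A : Set G} (hA : (H : Set G) * A = A) {h : G}
    (hh : h ∈ H) : lTrans G h (indBCF G A) = indBCF G A := by
  have hmul : ∀ k ∈ H, ∀ t ∈ A, k * t ∈ A := fun k hk t ht => hA ▸ Set.mul_mem_mul hk ht
  ext t
  have : h⁻¹ * t ∈ A ↔ t ∈ A :=
    ⟨fun ht => by simpa using hmul h hh _ ht, hmul _ (H.inv_mem hh) t⟩
  simp [lTrans_apply, indBCF_apply, this]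

lemma indBCF_inter (A B : Set G) : indBCF G (A ∩ B) = indBCF G A * indBCF G B := by
  ext t
  by_cases hA : t ∈ A <;> simp [indBCF_apply, hA]

end Means

/-- Let `G = N ⋊ L` be a countable amenable group with `N` abelian normal and `L`
abelian. If `C ⊆ G` is left `N`-invariant and `D ⊆ G` is left `L`-invariant, then
`λ(C ∩ D) = λ(C)·λ(D)` for every extreme left-invariant mean `λ` on `G`. -/
theorem extreme_mean_multiplicative_on_invariant_sets {G : Type*} [Group G] [Countable G]
    [TopologicalSpace G] [DiscreteTopology G]
    (N L : Subgroup G) [N.Normal]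
    (hNab : ∀ a ∈ N, ∀ b ∈ N, a * b = b * a)
    (hLab : ∀ a ∈ L, ∀ b ∈ L, a * b = b * a)
    (hNL : N ⊓ L = ⊥)
    (hprod : ∀ g : G, ∃ n ∈ N, ∃ l ∈ L, g = n * l)
    (C D : Set G) (hC : (N : Set G) * C = C) (hD : (L : Set G) * D = D)
    (lam : (G →ᵇ ℝ) →ₗ[ℝ] ℝ)
    (hlam : lam ∈ Set.extremePoints ℝ {m : (G →ᵇ ℝ) →ₗ[ℝ] ℝ | IsLeftInvariantMean G m}) :
    lam (indBCF G (C ∩ D)) = lam (indBCF G C) * lam (indBCF G D) := by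
  have hm := hlam.1.1
  rw [← weak_ergodic hlam hlam.1 (indBCF_nonneg C) (indBCF_le_one C),
    ← hm.map_const (lam (indBCF G (C ∩ D))), indBCF_inter]
  congr 1
  ext g
  obtain ⟨n, hn, l, hl, hg⟩ := hprod g⁻¹
  obtain rfl : g = l⁻¹ * n⁻¹ := by rw [← mul_inv_rev, ← hg, inv_inv]
  have hl' := L.inv_mem hl
  rw [correlation_apply, lTrans_mul, lTrans_indBCF_of_mem hC (N.inv_mem hn)]
  conv_rhs => rw [← lTrans_indBCF_of_mem hD hl', ← lTrans_mul_mul, hlam.1.2]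
  rfl
end
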